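/- Fix integers l ≥ 1, k ≥ 1 with m = kl ≥ 2 and an integer n ≥ 0. Define E(k,l,n) to be the set of d ∈ ℤ^{ℤ/mℤ} such that Σ_{j∈ℤ/mℤ, j ≡ i (mod l)} d_j = n for every i ∈ ℤ/lℤ, and such that d lies in the same W_m^aff-orbit as r·δ_m for some integer r ≥ 0. Then the map sending d ∈ E(k,l,n) to the unique m-core λ with Res_m(λ) − d ∈ ℤδ_m is a bijection from E(k,l,n) onto the set of m-cores λ satisfying |λ| ≤ nl, |λ| ≡ nl (mod m), and Core_l(λ) = ∅. -/

import Mathlib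

/-- The generator `s_j` of the affine Weyl group acting (non-linearly) on `ℤ^{ℤ/mℤ}`. -/
def sZ (m : ℕ) (j : ZMod m) (d : ZMod m → ℤ) : ZMod m → ℤ :=
  fun i => if i = j then (if j = 0 then 1 else 0) + d (j + 1) + d (j - 1) - d j else d i

/-- `d` and `d'` lie in the same `W_m^aff`-orbit. -/
def SameOrbit (m : ℕ) (d d' : ZMod m → ℤ) : Prop :=
  ∃ js : List (ZMod m), d' = js.foldr (sZ m) d

/-- The `m`-residue of a box `(r, s)` of a Young diagram (0-based row `r`, column `s`). -/
def boxRes (m : ℕ) (c : ℕ × ℕ) : ZMod m := (c.2 : ZMod m) - (c.1 : ZMod m)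

/-- `Res_m(λ) ∈ ℤ^{ℤ/mℤ}`. -/
def Res (m : ℕ) (lam : YoungDiagram) : ZMod m → ℤ :=
  fun i => ((lam.cells.filter fun c => boxRes m c = i).card : ℤ)

/-- One step: `μ` is obtained from `λ` by removing exactly `m` boxes with pairwise
distinct `m`-residues. -/
def RemoveStep (m : ℕ) (lam mu : YoungDiagram) : Prop :=
  mu ≤ lam ∧ (lam.cells \ mu.cells).card = m ∧
    Set.InjOn (boxRes m) ↑(lam.cells \ mu.cells)

/-- `ν` can be obtained from `λ` by a finite sequence of `m`-box removal steps. -/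
def Reaches (m : ℕ) (lam nu : YoungDiagram) : Prop :=
  Relation.ReflTransGen (fun a b => RemoveStep m a b) lam nu

/-- `λ` is an `m`-core. -/
def IsCore (m : ℕ) (lam : YoungDiagram) : Prop :=
  ¬ ∃ mu : YoungDiagram, RemoveStep m lam mu

/-- The number of boxes of `lam` of content `c`. -/
def contentCount (lam : YoungDiagram) (c : ℤ) : ℤ :=
  ((lam.cells.filter fun x => (x.2 : ℤ) - x.1 = c).card : ℤ)

/-- The bead indicator of the Maya diagram attached to a content-count function `h`. -/
def bead (h : ℤ → ℤ) (c : ℤ) : ℤ := h c - h (c + 1) + if c < 0 then 1 else 0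

/-- The functions `ℤ → ℤ` that are content-count functions of Young diagrams. -/
def IsProfile (h : ℤ → ℤ) : Prop :=
  h.support.Finite ∧ ∀ c, bead h c = 0 ∨ bead h c = 1

theorem contentCount_nonneg (lam : YoungDiagram) (c : ℤ) : 0 ≤ contentCount lam c :=
  Int.natCast_nonneg _

theorem mem_diagonal_iff (lam : YoungDiagram) (c : ℤ) (t : ℕ) :
    (t + (-c).toNat, t + c.toNat) ∈ lam ↔ (t : ℤ) < contentCount lam c := by
  classical
  set f : ℕ → ℕ × ℕ := fun t => (t + (-c).toNat, t + c.toNat) with hf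
  have hex : ∃ t, f t ∉ lam := by
    refine ⟨lam.rowLen 0, fun h => ?_⟩
    have h0 : (0, lam.rowLen 0 + c.toNat) ∈ lam := lam.up_left_mem (Nat.zero_le _) le_rfl h
    rw [YoungDiagram.mem_iff_lt_rowLen] at h0
    omega
  have hlow : ∀ t, f t ∈ lam ↔ t < Nat.find hex := by
    intro t
    constructor
    · intro h
      by_contra! hle
      exact Nat.find_spec hex (lam.up_left_mem (Nat.add_le_add_right hle _)
        (Nat.add_le_add_right hle _) h)
    · intro h
      simpa using Nat.find_min hex h
  have hinj : Function.Injective f := fun a b h => by simpa [hf] using h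
  have himg : lam.cells.filter (fun x => (x.2 : ℤ) - x.1 = c) =
      (Finset.range (Nat.find hex)).image f := by
    ext ⟨r, s⟩
    simp only [Finset.mem_filter, YoungDiagram.mem_cells, Finset.mem_image, Finset.mem_range]
    constructor
    · rintro ⟨h, hc⟩
      have hfrs : f (min r s) = (r, s) := by
        simp only [hf, Prod.mk.injEq]; omega
      exact ⟨min r s, (hlow _).1 (hfrs ▸ h), hfrs⟩
    · rintro ⟨t, ht, hfrs⟩
      refine ⟨hfrs ▸ (hlow t).2 ht, ?_⟩
      simp only [hf, Prod.mk.injEq] at hfrs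
      omega
  rw [contentCount, himg, Finset.card_image_of_injective _ hinj, Finset.card_range]
  exact (hlow t).trans (by norm_cast)

theorem mem_iff_lt_contentCount (lam : YoungDiagram) (r s : ℕ) :
    (r, s) ∈ lam ↔ ((min r s : ℕ) : ℤ) < contentCount lam ((s : ℤ) - r) := by
  rw [← mem_diagonal_iff]
  have h1 : min r s + (-((s : ℤ) - r)).toNat = r := by omega
  have h2 : min r s + ((s : ℤ) - r).toNat = s := by omega
  rw [h1, h2]

theorem contentCount_injective : Function.Injective contentCount := by
  intro lam mu h
  ext ⟨r, s⟩
  rw [YoungDiagram.mem_cells, YoungDiagram.mem_cells, mem_iff_lt_contentCount,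
    mem_iff_lt_contentCount, h]

theorem isProfile_contentCount (lam : YoungDiagram) : IsProfile (contentCount lam) := by
  constructor
  · refine (lam.cells.image fun x => (x.2 : ℤ) - x.1).finite_toSet.subset fun c hc => ?_
    by_contra hne
    refine hc ?_
    simp only [contentCount, Nat.cast_eq_zero, Finset.card_eq_zero,
      Finset.filter_eq_empty_iff]
    intro x hx hxc
    exact hne (by simpa using ⟨x.1, x.2, hx, hxc⟩)
  · intro c
    have h0 := contentCount_nonneg lam c
    have h1 := contentCount_nonneg lam (c + 1)
    have key : ∀ r s : ℕ, (r, s) ∈ lam ↔ _ := mem_iff_lt_contentCount lam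
    have left : ∀ r s : ℕ, (r, s + 1) ∈ lam → (r, s) ∈ lam :=
      fun r s => lam.up_left_mem le_rfl (Nat.le_succ s)
    have up : ∀ r s : ℕ, (r + 1, s) ∈ lam → (r, s) ∈ lam :=
      fun r s => lam.up_left_mem (Nat.le_succ r) le_rfl
    have transfer : ∀ t t' : ℕ, ∀ a b : ℤ,
        ((t + (-a).toNat, t + a.toNat) ∈ lam → (t' + (-b).toNat, t' + b.toNat) ∈ lam) →
        (t : ℤ) < contentCount lam a → (t' : ℤ) < contentCount lam b := by
      intro t t' a b h
      rwa [mem_diagonal_iff, mem_diagonal_iff] at h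
    obtain ⟨A, hA⟩ := Int.eq_ofNat_of_zero_le h0
    obtain ⟨B, hB⟩ := Int.eq_ofNat_of_zero_le h1
    unfold bead
    rcases lt_or_ge c 0 with hc | hc
    · have hle : A ≤ B := by
        by_contra! hlt
        have := transfer B B c (c + 1) (fun h => by
          have e : B + (-c).toNat = B + (-(c + 1)).toNat + 1 := by omega
          have e' : B + c.toNat = B + (c + 1).toNat := by omega
          rw [e, e'] at h
          exact up _ _ h) (by omega)
        omega
      have hge : B ≤ A + 1 := by
        by_contra! hlt
        have := transfer (A + 1) A (c + 1) c (fun h => by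
          have e : A + 1 + (-(c + 1)).toNat = A + (-c).toNat := by omega
          have e' : A + 1 + (c + 1).toNat = A + c.toNat + 1 := by omega
          rw [e, e'] at h
          exact left _ _ h) (by omega)
        omega
      simp only [hc, if_true]
      omega
    · have hle : B ≤ A := by
        by_contra! hlt
        have := transfer A A (c + 1) c (fun h => by
          have e : A + (-(c + 1)).toNat = A + (-c).toNat := by omega
          have e' : A + (c + 1).toNat = A + c.toNat + 1 := by omega
          rw [e, e'] at h
          exact left _ _ h) (by omega)
        omega
      have hge : A ≤ B + 1 := by
        by_contra! hlt
        have := transfer (B + 1) B c (c + 1) (fun h => by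
          have e : B + 1 + (-c).toNat = B + (-(c + 1)).toNat + 1 := by omega
          have e' : B + 1 + c.toNat = B + (c + 1).toNat := by omega
          rw [e, e'] at h
          exact up _ _ h) (by omega)
        omega
      simp only [not_lt.2 hc, if_false]
      omega

theorem exists_bound_of_finite_support {h : ℤ → ℤ} (hf : h.support.Finite) :
    ∃ N : ℕ, ∀ c : ℤ, (N : ℤ) ≤ |c| → h c = 0 := by
  refine ⟨∑ c ∈ hf.toFinset, c.natAbs + 1, fun c hc => ?_⟩
  by_contra hne
  have := Finset.single_le_sum (f := fun c : ℤ => c.natAbs) (fun _ _ => Nat.zero_le _)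
    (hf.mem_toFinset.2 hne)
  rw [Int.abs_eq_natAbs] at hc
  have hlt : c.natAbs < c.natAbs := by
    refine this.trans_lt (Nat.lt_of_succ_le ?_)
    exact_mod_cast hc
  exact lt_irrefl _ hlt

theorem IsProfile.nonneg {h : ℤ → ℤ} (hp : IsProfile h) (c : ℤ) : 0 ≤ h c := by
  obtain ⟨N, hN⟩ := exists_bound_of_finite_support hp.1
  rcases lt_or_ge c 0 with hc | hc
  · have hmono : ∀ n : ℕ, h (c - n) ≤ h c := by
      intro n
      induction n with
      | zero => simp
      | succ n ih =>
        have := hp.2 (c - (n + 1 : ℕ))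
        have e : c - (n + 1 : ℕ) + 1 = c - n := by push_cast; ring
        rw [bead, if_pos (by omega), e] at this
        omega
    have := hmono N
    rwa [hN _ (by rw [abs_of_nonpos (by omega)]; omega)] at this
  · have hmono : ∀ n : ℕ, h (c + n) ≤ h c := by
      intro n
      induction n with
      | zero => simp
      | succ n ih =>
        have := hp.2 (c + n)
        have e : c + (n + 1 : ℕ) = c + n + 1 := by push_cast; ring
        rw [bead, if_neg (by omega)] at this
        rw [e]
        omega
    have := hmono N
    rwa [hN _ (by rw [abs_of_nonneg (by omega)]; omega)] at this

theorem IsProfile.exists_youngDiagram {h : ℤ → ℤ} (hp : IsProfile h) :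
    ∃ lam : YoungDiagram, contentCount lam = h := by
  classical
  set C : Finset (ℕ × ℕ) := hp.1.toFinset.biUnion fun c =>
    (Finset.range (h c).toNat).image fun t => (t + (-c).toNat, t + c.toNat) with hC
  have hmem : ∀ r s : ℕ, (r, s) ∈ C ↔ ((min r s : ℕ) : ℤ) < h ((s : ℤ) - r) := by
    intro r s
    simp only [hC, Finset.mem_biUnion, Set.Finite.mem_toFinset, Function.mem_support,
      Finset.mem_image, Finset.mem_range, Prod.mk.injEq]
    constructor
    · rintro ⟨c, -, t, ht, rfl, rfl⟩
      have e : ((t + c.toNat : ℕ) : ℤ) - (t + (-c).toNat : ℕ) = c := by omega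
      rw [e]
      omega
    · intro hlt
      exact ⟨(s : ℤ) - r, by omega, min r s, by omega, by omega, by omega⟩
  have hup : ∀ r s : ℕ, (r + 1, s) ∈ C → (r, s) ∈ C := by
    intro r s
    rw [hmem, hmem]
    have := hp.2 ((s : ℤ) - (r + 1 : ℕ))
    have e : (s : ℤ) - (r + 1 : ℕ) + 1 = s - r := by push_cast; ring
    rw [bead, e] at this
    split_ifs at this <;> omega
  have hleft : ∀ r s : ℕ, (r, s + 1) ∈ C → (r, s) ∈ C := by
    intro r s
    rw [hmem, hmem]
    have := hp.2 ((s : ℤ) - r)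
    have e : ((s + 1 : ℕ) : ℤ) - r = (s : ℤ) - r + 1 := by push_cast; ring
    rw [bead] at this
    rw [e]
    split_ifs at this <;> omega
  have hups : ∀ n r s : ℕ, (r + n, s) ∈ C → (r, s) ∈ C := by
    intro n
    induction n with
    | zero => exact fun r s h => h
    | succ n ih => exact fun r s h => ih r s (hup _ _ h)
  have hlefts : ∀ n r s : ℕ, (r, s + n) ∈ C → (r, s) ∈ C := by
    intro n
    induction n with
    | zero => exact fun r s h => h
    | succ n ih => exact fun r s h => ih r s (hleft _ _ h)
  have hlow : IsLowerSet (C : Set (ℕ × ℕ)) := by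
    rintro ⟨r, s⟩ ⟨r', s'⟩ hle hrs
    obtain ⟨h1, h2⟩ := Prod.mk_le_mk.1 hle
    obtain ⟨a, rfl⟩ := Nat.exists_eq_add_of_le h1
    obtain ⟨b, rfl⟩ := Nat.exists_eq_add_of_le h2
    exact hups a r' s' (hlefts b _ _ hrs)
  refine ⟨⟨C, hlow⟩, funext fun c => ?_⟩
  have hiff : ∀ t : ℕ, (t : ℤ) < contentCount ⟨C, hlow⟩ c ↔ (t : ℤ) < h c := by
    intro t
    rw [← mem_diagonal_iff, ← YoungDiagram.mem_cells]
    simp only [hmem]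
    have e : ((t + c.toNat : ℕ) : ℤ) - (t + (-c).toNat : ℕ) = c := by omega
    have e' : min (t + (-c).toNat) (t + c.toNat) = t := by omega
    rw [e, e']
  have h0 := contentCount_nonneg ⟨C, hlow⟩ c
  have h1 := hp.nonneg c
  have h2 := hiff (h c).toNat
  have h3 := hiff (contentCount ⟨C, hlow⟩ c).toNat
  omega

theorem le_iff_contentCount_le {lam mu : YoungDiagram} :
    mu ≤ lam ↔ ∀ c, contentCount mu c ≤ contentCount lam c := by
  constructor
  · intro h c
    exact Int.ofNat_le.2 (Finset.card_le_card (Finset.filter_subset_filter _ h))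
  · rintro h ⟨r, s⟩ hrs
    rw [mem_iff_lt_contentCount] at hrs ⊢
    exact hrs.trans_le (h _)

theorem Res_nonneg (m : ℕ) (lam : YoungDiagram) (i : ZMod m) : 0 ≤ Res m lam i :=
  Int.natCast_nonneg _

theorem sum_Res (m : ℕ) [NeZero m] (lam : YoungDiagram) :
    ∑ i, Res m lam i = (lam.cells.card : ℤ) := by
  rw [Finset.card_eq_sum_card_fiberwise (f := boxRes m) (t := Finset.univ)
    (fun _ _ => Finset.mem_coe.2 (Finset.mem_univ _))]
  simp [Res]

theorem Res_bot (m : ℕ) (i : ZMod m) : Res m ⊥ i = 0 := by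
  simp [Res]

theorem RemoveStep.res_eq {m : ℕ} [NeZero m] {lam mu : YoungDiagram}
    (h : RemoveStep m lam mu) (i : ZMod m) : Res m lam i = Res m mu i + 1 := by
  classical
  obtain ⟨hle, hcard, hinj⟩ := h
  have himg : (lam.cells \ mu.cells).image (boxRes m) = Finset.univ := by
    apply Finset.eq_univ_of_card
    rw [Finset.card_image_of_injOn hinj, hcard, ZMod.card]
  obtain ⟨x, hx, hxi⟩ := Finset.mem_image.1 (himg ▸ Finset.mem_univ i)
  have hone : (lam.cells \ mu.cells).filter (fun c => boxRes m c = i) = {x} := by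
    ext y
    simp only [Finset.mem_filter, Finset.mem_singleton]
    constructor
    · rintro ⟨hy, hyi⟩
      exact hinj hy hx (hyi.trans hxi.symm)
    · rintro rfl
      exact ⟨hx, hxi⟩
  have hsplit : lam.cells.filter (fun c => boxRes m c = i) =
      mu.cells.filter (fun c => boxRes m c = i) ∪
        (lam.cells \ mu.cells).filter (fun c => boxRes m c = i) := by
    rw [← Finset.filter_union, Finset.union_sdiff_of_subset hle]
  have hdisj : Disjoint (mu.cells.filter fun c => boxRes m c = i)
      ((lam.cells \ mu.cells).filter fun c => boxRes m c = i) :=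
    Finset.disjoint_filter_filter Finset.disjoint_sdiff
  rw [Res, Res, hsplit, Finset.card_union_of_disjoint hdisj, hone]
  simp

theorem isCore_bot (m : ℕ) [NeZero m] : IsCore m ⊥ := by
  rintro ⟨mu, hmu⟩
  have h := hmu.res_eq 0
  rw [Res_bot] at h
  have := Res_nonneg m mu 0
  omega

theorem Reaches.res_eq {m : ℕ} [NeZero m] {lam nu : YoungDiagram} (h : Reaches m lam nu) :
    ∃ w : ℤ, ∀ i, Res m lam i = Res m nu i + w := by
  induction h with
  | refl => exact ⟨0, fun i => by simp⟩
  | tail _ hstep ih =>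
    obtain ⟨w, hw⟩ := ih
    exact ⟨w + 1, fun i => by rw [hw, hstep.res_eq]; ring⟩

theorem exists_reaches_isCore (m : ℕ) [NeZero m] (lam : YoungDiagram) :
    ∃ nu, Reaches m lam nu ∧ IsCore m nu := by
  induction hn : lam.cells.card using Nat.strong_induction_on generalizing lam with
  | _ n ih =>
    by_cases hc : IsCore m lam
    · exact ⟨lam, Relation.ReflTransGen.refl, hc⟩
    · obtain ⟨mu, hmu⟩ := not_not.1 hc
      have hlt : mu.cells.card < n := by
        have hsd := Finset.card_sdiff_add_card_eq_card (show mu.cells ⊆ lam.cells from hmu.1)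
        have := hmu.2.1
        have := NeZero.pos m
        omega
      obtain ⟨nu, hnu, hcore⟩ := ih _ hlt mu rfl
      exact ⟨nu, Relation.ReflTransGen.head hmu hnu, hcore⟩

theorem intCast_sub_eq_boxRes (m : ℕ) (x : ℕ × ℕ) :
    (((x.2 : ℤ) - x.1 : ℤ) : ZMod m) = boxRes m x := by
  simp [boxRes]

/-- In an `m`-core, the position `m` below a bead is occupied by a bead. -/
theorem IsCore.bead_sub {m : ℕ} [NeZero m] {lam : YoungDiagram} (hcore : IsCore m lam) (x : ℤ)
    (hx : bead (contentCount lam) x = 1) : bead (contentCount lam) (x - m) = 1 := by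
  classical
  have hp := isProfile_contentCount lam
  refine (hp.2 (x - m)).resolve_left fun hx0 => hcore ?_
  have hmpos : (0 : ℤ) < m := by exact_mod_cast NeZero.pos m
  set h := contentCount lam with hh
  set h' : ℤ → ℤ := fun c => h c - if x - m < c ∧ c ≤ x then 1 else 0 with hh'
  have hp' : IsProfile h' := by
    constructor
    · refine (hp.1.union (Set.finite_Ioc (x - m) x)).subset fun c hc => ?_
      by_contra hne
      simp only [Set.mem_union, Function.mem_support, Set.mem_Ioc, not_or, not_not] at hne
      exact hc (by simp [hh', hne.1, hne.2])
    · intro c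
      have hc := hp.2 c
      rcases eq_or_ne c x with rfl | hcx
      · left
        simp only [bead, hh']
        rw [bead] at hx
        split_ifs at hx ⊢ <;> omega
      · rcases eq_or_ne c (x - m) with rfl | hcm
        · right
          simp only [bead, hh']
          rw [bead] at hx0
          split_ifs at hx0 ⊢ <;> omega
        · simp only [bead, hh']
          rw [bead] at hc
          split_ifs at hc ⊢ <;> omega
  obtain ⟨mu, hmu⟩ := hp'.exists_youngDiagram
  have hmem : ∀ r s : ℕ, (r, s) ∈ lam.cells \ mu.cells ↔
      (x - m < (s : ℤ) - r ∧ (s : ℤ) - r ≤ x) ∧ ((min r s : ℕ) : ℤ) = h' ((s : ℤ) - r) := by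
    intro r s
    rw [Finset.mem_sdiff, YoungDiagram.mem_cells, YoungDiagram.mem_cells,
      mem_iff_lt_contentCount, mem_iff_lt_contentCount, hmu, ← hh]
    simp only [hh']
    split_ifs <;> omega
  have hinj : Set.InjOn (boxRes m) ↑(lam.cells \ mu.cells) := by
    rintro ⟨r, s⟩ h1 ⟨r', s'⟩ h2 heq
    rw [Finset.mem_coe, hmem] at h1 h2
    rw [← intCast_sub_eq_boxRes, ← intCast_sub_eq_boxRes, ZMod.intCast_eq_intCast_iff,
      Int.modEq_iff_dvd] at heq
    obtain ⟨t, ht⟩ := heq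
    simp only at ht
    have ht0 : t = 0 := by
      have h3 : (m : ℤ) * t < m * 1 := by omega
      have h4 : (m : ℤ) * (-1) < m * t := by omega
      have := lt_of_mul_lt_mul_left h3 hmpos.le
      have := lt_of_mul_lt_mul_left h4 hmpos.le
      omega
    subst ht0
    have e : (s' : ℤ) - r' = s - r := by linarith
    rw [e] at h2
    rw [Prod.mk.injEq]
    omega
  refine ⟨mu, le_iff_contentCount_le.2 fun c => ?_, ?_, hinj⟩
  · rw [hmu, ← hh]
    simp only [hh']
    split_ifs <;> omega
  · have himg : (lam.cells \ mu.cells).image (fun y => (y.2 : ℤ) - y.1) =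
        Finset.Ioc (x - m) x := by
      ext c
      simp only [Finset.mem_image, Finset.mem_Ioc]
      constructor
      · rintro ⟨⟨r, s⟩, hrs, rfl⟩
        exact ((hmem r s).1 hrs).1
      · intro hc
        have h0 := hp'.nonneg c
        refine ⟨((h' c).toNat + (-c).toNat, (h' c).toNat + c.toNat), ?_, by simp only; omega⟩
        rw [hmem]
        have e : (((h' c).toNat + c.toNat : ℕ) : ℤ) - ((h' c).toNat + (-c).toNat : ℕ) = c := by
          omega
        rw [e]
        exact ⟨hc, by omega⟩
    have hinj' : Set.InjOn (fun y : ℕ × ℕ => (y.2 : ℤ) - y.1) ↑(lam.cells \ mu.cells) :=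
      fun y hy z hz hyz => hinj hy hz (by
        rw [← intCast_sub_eq_boxRes, ← intCast_sub_eq_boxRes]
        exact congrArg _ hyz)
    rw [← Finset.card_image_of_injOn hinj', himg, Int.card_Ioc]
    omega

/-- The sum of `h` over the integers of residue `j` modulo `m`. -/
noncomputable def residueSum (m : ℕ) (h : ℤ → ℤ) (j : ZMod m) : ℤ :=
  ∑ᶠ c : ℤ, if (c : ZMod m) = j then h c else 0

theorem finite_support_ite {h : ℤ → ℤ} (hf : h.support.Finite) (p : ℤ → Prop)
    [DecidablePred p] : (Function.support fun c => if p c then h c else 0).Finite :=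
  hf.subset fun c hc hc0 => hc (by simp only [hc0, ite_self])

theorem residueSum_add (m : ℕ) {g h : ℤ → ℤ} (hg : g.support.Finite) (hh : h.support.Finite)
    (j : ZMod m) :
    residueSum m (fun c => g c + h c) j = residueSum m g j + residueSum m h j := by
  rw [residueSum, residueSum, residueSum,
    ← finsum_add_distrib (finite_support_ite hg _) (finite_support_ite hh _)]
  congr 1 with c
  split_ifs <;> simp

theorem residueSum_sub (m : ℕ) {g h : ℤ → ℤ} (hg : g.support.Finite) (hh : h.support.Finite)
    (j : ZMod m) :
    residueSum m (fun c => g c - h c) j = residueSum m g j - residueSum m h j := by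
  rw [residueSum, residueSum, residueSum,
    ← finsum_sub_distrib (finite_support_ite hg _) (finite_support_ite hh _)]
  congr 1 with c
  split_ifs <;> simp

theorem residueSum_shift (m : ℕ) (h : ℤ → ℤ) (a : ℤ) (j : ZMod m) :
    residueSum m (fun c => h (c + a)) j = residueSum m h (j + a) := by
  rw [residueSum, residueSum, ← finsum_comp_equiv (Equiv.addRight a)
    (f := fun c : ℤ => if (c : ZMod m) = j + a then h c else 0)]
  congr 1 with c
  simp

theorem finite_support_shift {h : ℤ → ℤ} (hf : h.support.Finite) (a : ℤ) :
    (Function.support fun c => h (c + a)).Finite :=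
  hf.preimage (f := fun c => c + a) (add_left_injective a).injOn

theorem Res_eq_residueSum (m : ℕ) (lam : YoungDiagram) (j : ZMod m) :
    Res m lam j = residueSum m (contentCount lam) j := by
  classical
  have hf := (isProfile_contentCount lam).1
  have hsub : (Function.support fun c : ℤ => if (c : ZMod m) = j then contentCount lam c else 0) ⊆
      ↑(lam.cells.image fun x => (x.2 : ℤ) - x.1) := by
    intro c hc
    by_contra hne
    refine hc ?_
    have : contentCount lam c = 0 := by
      simp only [contentCount, Nat.cast_eq_zero, Finset.card_eq_zero,
        Finset.filter_eq_empty_iff]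
      exact fun x hx hxc => hne (Finset.mem_coe.2 (Finset.mem_image.2 ⟨x, hx, hxc⟩))
    simp only [this, ite_self]
  rw [residueSum, finsum_eq_sum_of_support_subset _ hsub, Res,
    Finset.card_eq_sum_card_fiberwise (f := fun x : ℕ × ℕ => (x.2 : ℤ) - x.1)
      (t := lam.cells.image fun x => (x.2 : ℤ) - x.1)
      (fun x hx => Finset.mem_coe.2 (Finset.mem_image_of_mem _ (Finset.mem_filter.1 hx).1))]
  push_cast
  refine Finset.sum_congr rfl fun c _ => ?_
  rw [Finset.filter_filter]
  split_ifs with hc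
  · rw [contentCount]
    congr 2
    refine Finset.filter_congr fun x _ => ⟨fun h => h.2, fun h => ⟨?_, h⟩⟩
    rw [← intCast_sub_eq_boxRes, h, hc]
  · rw [Nat.cast_eq_zero, Finset.card_eq_zero, Finset.filter_eq_empty_iff]
    rintro x - ⟨h1, h2⟩
    exact hc (by rw [← h2, intCast_sub_eq_boxRes, h1])

theorem residueSum_bead_sub (m : ℕ) (lam mu : YoungDiagram) (j : ZMod m) :
    residueSum m (fun c => bead (contentCount lam) c - bead (contentCount mu) c) j =
      (Res m lam j - Res m mu j) - (Res m lam (j + 1) - Res m mu (j + 1)) := by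
  have hl := (isProfile_contentCount lam).1
  have hu := (isProfile_contentCount mu).1
  have hl' := finite_support_shift hl 1
  have hu' := finite_support_shift hu 1
  have hd : (Function.support fun c => contentCount lam c - contentCount mu c).Finite :=
    (hl.union hu).subset (Function.support_sub _ _)
  have hd' : (Function.support fun c =>
      contentCount lam (c + 1) - contentCount mu (c + 1)).Finite :=
    (hl'.union hu').subset (Function.support_sub _ _)
  have e : (fun c => bead (contentCount lam) c - bead (contentCount mu) c) = fun c =>
      (contentCount lam c - contentCount mu c) -
        (contentCount lam (c + 1) - contentCount mu (c + 1)) := by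
    funext c
    simp only [bead]
    ring
  have hs := residueSum_shift m (contentCount lam) 1 j
  have hs' := residueSum_shift m (contentCount mu) 1 j
  rw [Int.cast_one] at hs hs'
  rw [e, residueSum_sub m hd hd', residueSum_sub m hl hu, residueSum_sub m hl' hu', hs, hs']
  simp only [Res_eq_residueSum]

theorem IsCore.bead_sub_mul {m : ℕ} [NeZero m] {lam : YoungDiagram} (hcore : IsCore m lam)
    (x : ℤ) (hx : bead (contentCount lam) x = 1) (t : ℕ) :
    bead (contentCount lam) (x - m * t) = 1 := by
  induction t with
  | zero => simpa using hx
  | succ t ih =>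
    have := hcore.bead_sub _ ih
    rwa [show x - m * t - m = x - m * (t + 1 : ℕ) by push_cast; ring] at this

theorem IsCore.bead_le {m : ℕ} [NeZero m] {lam mu : YoungDiagram} (hlam : IsCore m lam)
    (hmu : IsCore m mu) (w : ℤ) (hw : ∀ i, Res m lam i = Res m mu i + w) (x : ℤ) :
    bead (contentCount lam) x ≤ bead (contentCount mu) x := by
  have bl := (isProfile_contentCount lam).2
  have bu := (isProfile_contentCount mu).2
  by_contra! hlt
  have hl : bead (contentCount lam) x = 1 := by have := bl x; have := bu x; omega
  have hu : bead (contentCount mu) x = 0 := by have := bu x; omega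
  have hpos : ∀ c : ℤ, (c : ZMod m) = (x : ZMod m) →
      0 ≤ bead (contentCount lam) c - bead (contentCount mu) c := by
    intro c hc
    obtain ⟨t, ht⟩ := (Int.modEq_iff_dvd).1 ((ZMod.intCast_eq_intCast_iff _ _ _).1 hc)
    rcases bu c with hcu | hcu
    · rcases bl c with h | h <;> omega
    · obtain ⟨n, rfl | rfl⟩ := t.eq_nat_or_neg
      · have := hlam.bead_sub_mul x hl n
        rw [show x - m * n = c by linarith] at this
        omega
      · have := hmu.bead_sub_mul c hcu n
        rw [show c - m * n = x by linarith] at this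
        omega
  have hzero := residueSum_bead_sub m lam mu (x : ZMod m)
  rw [hw, hw] at hzero
  have hfin : (Function.support fun c =>
      bead (contentCount lam) c - bead (contentCount mu) c).Finite := by
    have h1 := (isProfile_contentCount lam).1
    have h2 := (isProfile_contentCount mu).1
    refine ((h1.union (finite_support_shift h1 1)).union
      (h2.union (finite_support_shift h2 1))).subset fun c hc => ?_
    by_contra hne
    simp only [Set.mem_union, Function.mem_support, not_or, not_not] at hne
    refine hc ?_
    simp only [bead, hne.1.1, hne.1.2, hne.2.1, hne.2.2, sub_self]
  have hle := single_le_finsum x (finite_support_ite hfin fun c => (c : ZMod m) = x) fun c => by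
    split_ifs with hc
    · exact hpos c hc
    · exact le_rfl
  rw [residueSum] at hzero
  rw [hzero] at hle
  simp only [if_true] at hle
  omega

theorem IsCore.eq_of_res {m : ℕ} [NeZero m] {lam mu : YoungDiagram} (hlam : IsCore m lam)
    (hmu : IsCore m mu) (w : ℤ) (hw : ∀ i, Res m lam i = Res m mu i + w) : lam = mu := by
  have hbead : ∀ x, bead (contentCount lam) x = bead (contentCount mu) x := fun x =>
    le_antisymm (hlam.bead_le hmu w hw x) (hmu.bead_le hlam (-w) (fun i => by rw [hw]; ring) x)
  apply contentCount_injective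
  funext c
  obtain ⟨N, hN⟩ := exists_bound_of_finite_support (isProfile_contentCount lam).1
  obtain ⟨M, hM⟩ := exists_bound_of_finite_support (isProfile_contentCount mu).1
  have hstep : ∀ n : ℕ, contentCount lam c - contentCount mu c =
      contentCount lam (c + n) - contentCount mu (c + n) := by
    intro n
    induction n with
    | zero => simp
    | succ n ih =>
      have h := hbead (c + n)
      rw [bead, bead, add_assoc c] at h
      rw [ih]
      push_cast
      linarith
  have h := hstep ((-c).toNat + N + M)
  have hbig : c + (((-c).toNat + N + M : ℕ) : ℤ) ≤ |c + (((-c).toNat + N + M : ℕ) : ℤ)| :=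
    le_abs_self _
  rw [hN (c + _) (by omega), hM (c + _) (by omega)] at h
  omega

/-- Reflecting the Maya diagram realizes the generator `s_j` on residue counts. -/
theorem exists_Res_eq_sZ {m : ℕ} (hm : 2 ≤ m) (j : ZMod m) (lam : YoungDiagram) :
    ∃ mu, Res m mu = sZ m j (Res m lam) := by
  have : Fact (1 < m) := ⟨hm⟩
  have hp := isProfile_contentCount lam
  set h := contentCount lam with hh
  set h' : ℤ → ℤ := fun c =>
    if (c : ZMod m) = j then h (c + -1) + h (c + 1) - h c + (if c = 0 then 1 else 0) else h c
    with hh'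
  have hfm := finite_support_shift hp.1 (-1)
  have hfp := finite_support_shift hp.1 1
  have hfs : (Function.support fun c => h (c + -1) + h (c + 1)).Finite :=
    (hfm.union hfp).subset (Function.support_add _ _)
  have hfd : (Function.support fun c => h (c + -1) + h (c + 1) - h c).Finite :=
    (hfs.union hp.1).subset (Function.support_sub _ _)
  have hf0 : (Function.support fun c : ℤ => if c = 0 then (1 : ℤ) else 0).Finite :=
    (Set.finite_singleton 0).subset fun c hc => by
      by_contra hne
      exact hc (if_neg hne)
  have hp' : IsProfile h' := by
    constructor
    · refine ((hfd.union hf0).union hp.1).subset fun c hc => ?_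
      by_contra hne
      simp only [Set.mem_union, Function.mem_support, not_or, not_not] at hne
      refine hc ?_
      simp only [hh']
      rw [hne.1.1, hne.1.2, hne.2]
      simp
    · intro c
      by_cases hc : (c : ZMod m) = j
      · have hc1 : ((c + 1 : ℤ) : ZMod m) ≠ j := by
          rw [← hc]; simp
        have e : bead h' c = bead h (c + -1) := by
          simp only [bead, hh', if_pos hc, if_neg hc1, neg_add_cancel_right]
          split_ifs <;> omega
        rw [e]
        exact hp.2 _
      · by_cases hc1 : ((c + 1 : ℤ) : ZMod m) = j
        · have e : bead h' c = bead h (c + 1) := by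
            simp only [bead, hh', if_neg hc, if_pos hc1, add_neg_cancel_right]
            split_ifs <;> omega
          rw [e]
          exact hp.2 _
        · have e : bead h' c = bead h c := by
            simp only [bead, hh', if_neg hc, if_neg hc1]
          rw [e]
          exact hp.2 _
  obtain ⟨mu, hmu⟩ := hp'.exists_youngDiagram
  refine ⟨mu, funext fun i => ?_⟩
  rw [sZ]
  by_cases hij : i = j
  · rw [if_pos hij]
    subst hij
    have e : residueSum m h' i = residueSum m
        (fun c => h (c + -1) + h (c + 1) - h c + (if c = 0 then 1 else 0)) i := by
      rw [residueSum, residueSum]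
      congr 1 with c
      by_cases hc : (c : ZMod m) = i
      · simp only [hh', if_pos hc]
      · simp only [if_neg hc]
    have e0 : residueSum m (fun c => if c = 0 then 1 else 0) i = if i = 0 then 1 else 0 := by
      rw [residueSum, finsum_eq_single _ 0 (fun c hc => by simp [hc])]
      simp [eq_comm]
    have hsm := residueSum_shift m h (-1) i
    have hsp := residueSum_shift m h 1 i
    simp only [Int.cast_neg, Int.cast_one, ← sub_eq_add_neg] at hsm hsp
    simp only [Res_eq_residueSum, hmu, ← hh]
    simp only [← sub_eq_add_neg] at e hfm hfs hfd
    rw [e, residueSum_add m hfd hf0, residueSum_sub m hfs hp.1, residueSum_add m hfm hfp, e0,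
      hsm, hsp]
    ring
  · rw [if_neg hij, Res_eq_residueSum, Res_eq_residueSum, hmu, ← hh, residueSum, residueSum]
    congr 1 with c
    by_cases hc : (c : ZMod m) = i
    · simp only [hh', if_pos hc, if_neg (show (c : ZMod m) ≠ j from fun h => hij (hc ▸ h))]
    · simp only [if_neg hc]

/-- The change of `d j` under the reflection `s_j`. -/
def reflectionStep (m : ℕ) (d : ZMod m → ℤ) (j : ZMod m) : ℤ :=
  (if j = 0 then 1 else 0) + d (j + 1) + d (j - 1) - 2 * d j

theorem sum_comp_add {M : Type*} [AddCommMonoid M] {m : ℕ} [NeZero m] (f : ZMod m → M)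
    (a : ZMod m) : ∑ j, f (j + a) = ∑ j, f j :=
  Equiv.sum_comp (Equiv.addRight a) f

theorem sum_comp_sub {M : Type*} [AddCommMonoid M] {m : ℕ} [NeZero m] (f : ZMod m → M)
    (a : ZMod m) : ∑ j, f (j - a) = ∑ j, f j :=
  Equiv.sum_comp (Equiv.subRight a) f

theorem sum_reflectionStep {m : ℕ} [NeZero m] (d : ZMod m → ℤ) :
    ∑ j, reflectionStep m d j = 1 := by
  simp only [reflectionStep, Finset.sum_sub_distrib, Finset.sum_add_distrib, sum_comp_add d,
    sum_comp_sub d, ← Finset.mul_sum]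
  simp
  ring

theorem sum_reflectionStep_mul {m : ℕ} [NeZero m] (d : ZMod m → ℤ) :
    ∑ j, (reflectionStep m d j : ZMod m) * j = 0 := by
  have h1 := sum_comp_add (fun j => (d j : ZMod m) * (j - 1)) 1
  have h2 := sum_comp_sub (fun j => (d j : ZMod m) * (j + 1)) 1
  simp only [add_sub_cancel_right, sub_add_cancel] at h1 h2
  have h0 : ∀ j : ZMod m, (reflectionStep m d j : ZMod m) * j =
      (d (j + 1) : ZMod m) * j + (d (j - 1) : ZMod m) * j - 2 * ((d j : ZMod m) * j) := by
    intro j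
    rw [reflectionStep]
    by_cases hj : j = 0
    · simp [hj]
    · rw [if_neg hj]
      push_cast
      ring
  simp only [h0, Finset.sum_sub_distrib, Finset.sum_add_distrib, h1, h2]
  rw [← Finset.sum_add_distrib, ← Finset.sum_sub_distrib]
  exact Finset.sum_eq_zero fun j _ => by ring

theorem eq_apply_zero_of_apply_add_one {m : ℕ} [NeZero m] {f : ZMod m → ℤ}
    (hf : ∀ j, f (j + 1) = f j) (j : ZMod m) : f j = f 0 := by
  have hnat : ∀ n : ℕ, f n = f 0 := by
    intro n
    induction n with
    | zero => simp
    | succ n ih => rw [Nat.cast_succ, hf, ih]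
  simpa using hnat j.val

theorem eq_const_of_reflectionStep_nonneg {m : ℕ} [NeZero m] {d : ZMod m → ℤ}
    (hd : ∀ j, 0 ≤ reflectionStep m d j) (j : ZMod m) : d j = d 0 := by
  have hsum := sum_reflectionStep d
  obtain ⟨j₀, hj₀⟩ : ∃ j₀, 0 < reflectionStep m d j₀ := by
    by_contra! hle
    have := Finset.sum_nonpos fun j (_ : j ∈ Finset.univ) => hle j
    omega
  rw [← Finset.add_sum_erase _ _ (Finset.mem_univ j₀)] at hsum
  have hrest := Finset.sum_nonneg fun j (_ : j ∈ Finset.univ.erase j₀) => hd j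
  have hzero : ∀ j, j ≠ j₀ → reflectionStep m d j = 0 := fun j hj =>
    (Finset.sum_eq_zero_iff_of_nonneg fun j _ => hd j).1 (by omega) j
      (Finset.mem_erase.2 ⟨hj, Finset.mem_univ _⟩)
  have hone : reflectionStep m d j₀ = 1 := by omega
  have hj₀_zero : j₀ = 0 := by
    have h := sum_reflectionStep_mul d
    rw [Finset.sum_eq_single j₀ (fun j _ hj => by simp [hzero j hj]) (by simp), hone] at h
    simpa using h
  subst hj₀_zero
  have hharm : ∀ j, d (j + 1) - d j = d j - d (j - 1) := by
    intro j
    by_cases hj : j = 0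
    · subst hj
      rw [reflectionStep, if_pos rfl] at hone
      linarith
    · have := hzero j hj
      rw [reflectionStep, if_neg hj] at this
      linarith
  have hslope := eq_apply_zero_of_apply_add_one (f := fun j => d (j + 1) - d j) fun j => by
    have := hharm (j + 1)
    rwa [add_sub_cancel_right] at this
  have hzero' : ∑ j, (d (j + 1) - d j) = 0 := by
    rw [Finset.sum_sub_distrib, sum_comp_add d, sub_self]
  rw [Finset.sum_congr rfl fun j _ => hslope j, Finset.sum_const, Finset.card_univ, ZMod.card,
    nsmul_eq_mul] at hzero'
  have hs0 := (mul_eq_zero.1 hzero').resolve_left (by exact_mod_cast NeZero.ne m)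
  exact eq_apply_zero_of_apply_add_one (fun j => by
    have := hslope j
    linarith) j

theorem sum_sZ {m : ℕ} [NeZero m] (j : ZMod m) (d : ZMod m → ℤ) :
    ∑ i, sZ m j d i = ∑ i, d i + reflectionStep m d j := by
  have h : ∀ i, sZ m j d i = d i + if i = j then reflectionStep m d j else 0 := by
    intro i
    rw [sZ]
    by_cases hij : i = j
    · rw [if_pos hij, if_pos hij, reflectionStep, hij]
      ring
    · rw [if_neg hij, if_neg hij, add_zero]
  simp [h, Finset.sum_add_distrib]

theorem sZ_sZ {m : ℕ} (hm : 2 ≤ m) (j : ZMod m) (d : ZMod m → ℤ) :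
    sZ m j (sZ m j d) = d := by
  have : Fact (1 < m) := ⟨hm⟩
  funext i
  by_cases hij : i = j
  · subst hij
    simp [sZ]
  · simp [sZ, hij]

theorem sZ_add_const (m : ℕ) (j : ZMod m) (d : ZMod m → ℤ) (c : ℤ) :
    sZ m j (fun i => d i + c) = fun i => sZ m j d i + c := by
  funext i
  simp only [sZ]
  by_cases hij : i = j
  · rw [if_pos hij, if_pos hij]
    ring
  · rw [if_neg hij, if_neg hij]

theorem SameOrbit.add_const {m : ℕ} {d : ZMod m → ℤ} {r : ℤ}
    (h : SameOrbit m d fun _ => r) (c : ℤ) :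
    SameOrbit m (fun i => d i + c) fun _ => r + c := by
  obtain ⟨js, hjs⟩ := h
  have key : ∀ js : List (ZMod m), js.foldr (sZ m) (fun i => d i + c) =
      fun i => js.foldr (sZ m) d i + c := by
    intro js
    induction js with
    | nil => rfl
    | cons j js ih => rw [List.foldr_cons, ih, sZ_add_const, List.foldr_cons]
  exact ⟨js, by rw [key, ← hjs]⟩

theorem SameOrbit.exists_Res_eq {m : ℕ} (hm : 2 ≤ m) {d d' : ZMod m → ℤ}
    (h : SameOrbit m d d') (hd' : ∃ lam, Res m lam = d') : ∃ lam, Res m lam = d := by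
  obtain ⟨js, rfl⟩ := h
  induction js with
  | nil => exact hd'
  | cons j js ih =>
    obtain ⟨lam, hlam⟩ := hd'
    obtain ⟨mu, hmu⟩ := exists_Res_eq_sZ hm j lam
    refine ih ⟨mu, ?_⟩
    rw [hmu, hlam, List.foldr_cons, sZ_sZ hm]

theorem SameOrbit.symm {m : ℕ} (hm : 2 ≤ m) {d d' : ZMod m → ℤ} (h : SameOrbit m d d') :
    SameOrbit m d' d := by
  obtain ⟨js, rfl⟩ := h
  refine ⟨js.reverse, ?_⟩
  induction js with
  | nil => rfl
  | cons j js ih =>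
    rw [List.reverse_cons, List.foldr_append, List.foldr_cons, List.foldr_cons, List.foldr_nil,
      sZ_sZ hm, ← ih]

theorem SameOrbit.exists_isCore {m : ℕ} [NeZero m] (hm : 2 ≤ m) {d : ZMod m → ℤ}
    (h : SameOrbit m d fun _ => 0) : ∃ lam, IsCore m lam ∧ Res m lam = d := by
  obtain ⟨lam, hlam⟩ := h.exists_Res_eq hm ⟨⊥, funext fun i => Res_bot m i⟩
  refine ⟨lam, ?_, hlam⟩
  rintro ⟨mu, hmu⟩
  have hmud : Res m mu = fun i => d i + -1 := funext fun i => by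
    rw [← hlam, hmu.res_eq]
    ring
  obtain ⟨nu, hnu⟩ := ((h.add_const (-1)).symm hm).exists_Res_eq hm ⟨mu, hmud⟩
  have := Res_nonneg m nu 0
  simp [hnu] at this

theorem exists_sameOrbit_const {m : ℕ} [NeZero m] (hm : 2 ≤ m) (lam : YoungDiagram) :
    ∃ r : ℤ, SameOrbit m (Res m lam) fun _ => r := by
  induction hn : lam.cells.card using Nat.strong_induction_on generalizing lam with
  | _ n ih =>
    by_cases hd : ∀ j, 0 ≤ reflectionStep m (Res m lam) j
    · exact ⟨Res m lam 0, [], funext fun j => (eq_const_of_reflectionStep_nonneg hd j).symm⟩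
    · push Not at hd
      obtain ⟨j, hj⟩ := hd
      obtain ⟨mu, hmu⟩ := exists_Res_eq_sZ hm j lam
      have hsum := sum_sZ j (Res m lam)
      rw [← hmu, sum_Res, sum_Res] at hsum
      obtain ⟨r, js, hjs⟩ := ih mu.cells.card (by omega) mu rfl
      refine ⟨r, js ++ [j], ?_⟩
      rw [hjs, hmu, List.foldr_append, List.foldr_cons, List.foldr_nil]

theorem IsCore.sameOrbit_zero {m : ℕ} [NeZero m] (hm : 2 ≤ m) {lam : YoungDiagram}
    (hcore : IsCore m lam) : SameOrbit m (Res m lam) fun _ => 0 := by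
  obtain ⟨r, hr⟩ := exists_sameOrbit_const hm lam
  have h := hr.add_const (-r)
  rw [add_neg_cancel] at h
  obtain ⟨mu, hmu, hres⟩ := h.exists_isCore hm
  obtain rfl : mu = lam := hmu.eq_of_res hcore (-r) fun i => congrFun hres i
  rwa [← hres] at h

theorem val_cast_boxRes (k l : ℕ) [NeZero k] [NeZero l] (x : ℕ × ℕ) :
    ((boxRes (k * l) x).val : ZMod l) = boxRes l x := by
  have h : l ∣ k * l := Dvd.intro_left k rfl
  rw [ZMod.natCast_val, ← ZMod.castHom_apply (h := h), boxRes, map_sub, map_natCast, map_natCast,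
    boxRes]

theorem sum_fiber_Res (k l : ℕ) [NeZero k] [NeZero l] (lam : YoungDiagram) (i : ZMod l) :
    ∑ j ∈ Finset.univ.filter (fun j : ZMod (k * l) => ((j.val : ZMod l) = i)),
      Res (k * l) lam j = Res l lam i := by
  rw [Res, Finset.card_eq_sum_card_fiberwise (f := boxRes (k * l))
    (t := Finset.univ.filter (fun j : ZMod (k * l) => ((j.val : ZMod l) = i)))]
  · push_cast
    refine Finset.sum_congr rfl fun j hj => ?_
    rw [Res, Finset.filter_filter]
    congr 2
    refine Finset.filter_congr fun x _ => ⟨fun h => ⟨?_, h⟩, fun h => h.2⟩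
    rw [← val_cast_boxRes k l, h]
    exact (Finset.mem_filter.1 hj).2
  · intro x hx
    refine Finset.mem_coe.2 (Finset.mem_filter.2 ⟨Finset.mem_univ _, ?_⟩)
    rw [val_cast_boxRes]
    exact (Finset.mem_filter.1 hx).2

theorem card_fiber (k l : ℕ) [NeZero k] [NeZero l] (i : ZMod l) :
    (Finset.univ.filter (fun j : ZMod (k * l) => ((j.val : ZMod l) = i))).card = k := by
  have hlpos := NeZero.pos l
  have hlt : ∀ t < k, t * l + i.val < k * l := fun t ht => by
    have := ZMod.val_lt i
    have := Nat.mul_le_mul_right l (Nat.succ_le_of_lt ht)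
    rw [Nat.succ_mul] at this
    omega
  have hval : ∀ t < k, ((t * l + i.val : ℕ) : ZMod (k * l)).val = t * l + i.val :=
    fun t ht => ZMod.val_cast_of_lt (hlt t ht)
  refine Eq.trans ?_ (Finset.card_range k)
  symm
  refine Finset.card_bij (fun t _ => ((t * l + i.val : ℕ) : ZMod (k * l))) ?_ ?_ ?_
  · intro t ht
    rw [Finset.mem_filter, hval t (Finset.mem_range.1 ht)]
    simp
  · intro t ht t' ht' h
    have h' := congrArg ZMod.val h
    rw [hval t (Finset.mem_range.1 ht), hval t' (Finset.mem_range.1 ht')] at h'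
    exact Nat.eq_of_mul_eq_mul_right hlpos (Nat.add_right_cancel h')
  · intro j hj
    have hj' := (Finset.mem_filter.1 hj).2
    refine ⟨j.val / l, Finset.mem_range.2 (Nat.div_lt_of_lt_mul ?_), ?_⟩
    · exact (ZMod.val_lt j).trans_eq (mul_comm k l)
    · rw [← hj', ZMod.val_natCast, Nat.div_add_mod', ZMod.natCast_zmod_val]

/-- With `m = kl ≥ 2`: the map sending `d ∈ E(k,l,n)` to the unique `m`-core `λ` with
`Res_m(λ) - d ∈ ℤδ_m` is a bijection from `E(k,l,n)` onto the set of `m`-cores `λ` with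
`|λ| ≤ nl`, `|λ| ≡ nl (mod m)` and trivial `l`-core. Here `E(k,l,n)` is the set of
`d ∈ ℤ^{ℤ/mℤ}` whose fiber sums `Σ_{j ≡ i (mod l)} d_j` all equal `n` and which lie in
the `W_m^aff`-orbit of `r·δ_m` for some `r ≥ 0`. -/
theorem E_bijection_cores (l k : ℕ) [NeZero l] [NeZero k]
    (hl : 1 ≤ l) (hk : 1 ≤ k) (hm : 2 ≤ k * l) (n : ℕ) :
    ∃ g : {d : ZMod (k * l) → ℤ //
            (∀ i : ZMod l,
              ∑ j ∈ Finset.univ.filter (fun j : ZMod (k * l) => ((j.val : ZMod l) = i)), d j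
                = (n : ℤ)) ∧
            ∃ r : ℤ, 0 ≤ r ∧ SameOrbit (k * l) d (fun _ => r)} ≃
          {lam : YoungDiagram // IsCore (k * l) lam ∧
            lam.cells.card ≤ n * l ∧
            lam.cells.card % (k * l) = (n * l) % (k * l) ∧
            Reaches l lam ⊥},
      ∀ d, ∃ c : ℤ, ∀ i : ZMod (k * l), Res (k * l) (g d).1 i - d.1 i = c := by
  classical
  have hkpos : (0 : ℤ) < k := by exact_mod_cast hk
  have hlpos : (0 : ℤ) < l := by exact_mod_cast hl
  have forward : ∀ d : {d : ZMod (k * l) → ℤ //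
      (∀ i : ZMod l,
        ∑ j ∈ Finset.univ.filter (fun j : ZMod (k * l) => ((j.val : ZMod l) = i)), d j
          = (n : ℤ)) ∧
      ∃ r : ℤ, 0 ≤ r ∧ SameOrbit (k * l) d (fun _ => r)},
      ∃ lam : {lam : YoungDiagram // IsCore (k * l) lam ∧
        lam.cells.card ≤ n * l ∧ lam.cells.card % (k * l) = (n * l) % (k * l) ∧
        Reaches l lam ⊥},
      ∃ c : ℤ, ∀ i, Res (k * l) lam.1 i - d.1 i = c := by
    rintro ⟨d, hsum, r, hr, horb⟩
    have horb' : SameOrbit (k * l) (fun i => d i + -r) fun _ => 0 := by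
      have := horb.add_const (-r)
      rwa [add_neg_cancel] at this
    obtain ⟨lam, hcore, hres⟩ := horb'.exists_isCore hm
    have hfib : ∀ i, Res l lam i = n - r * k := by
      intro i
      rw [← sum_fiber_Res k l lam i, hres, Finset.sum_add_distrib, hsum, Finset.sum_const,
        card_fiber]
      simp
      ring
    have hcard : (lam.cells.card : ℤ) = n * l - r * (k * l) := by
      rw [← sum_Res l lam, Finset.sum_congr rfl fun i _ => hfib i]
      simp
      ring
    refine ⟨⟨lam, hcore, ?_, ?_, ?_⟩, -r, fun i => ?_⟩
    · have : 0 ≤ r * (k * l) := by positivity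
      zify
      linarith
    · zify
      rw [hcard]
      exact Int.sub_mul_emod_self_right _ _ _
    · obtain ⟨nu, hreach, hnu⟩ := exists_reaches_isCore l lam
      obtain ⟨w, hw⟩ := hreach.res_eq
      have : nu = ⊥ := hnu.eq_of_res (isCore_bot l) (n - r * k - w) fun i => by
        have := hw i
        rw [hfib] at this
        rw [Res_bot]
        linarith
      exact this ▸ hreach
    · simp only [hres]
      ring
  choose g hg using forward
  refine ⟨Equiv.ofBijective g ⟨?_, ?_⟩, hg⟩
  · intro d d' hdd
    obtain ⟨c, hc⟩ := hg d
    obtain ⟨c', hc'⟩ := hg d'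
    rw [← hdd] at hc'
    have hdiff : ∀ i, d.1 i = d'.1 i + (c' - c) := fun i => by
      have := hc i
      have := hc' i
      linarith
    have h0 := d.2.1 0
    rw [Finset.sum_congr rfl fun i _ => hdiff i, Finset.sum_add_distrib, d'.2.1 0,
      Finset.sum_const, card_fiber, nsmul_eq_mul, add_eq_left] at h0
    have hcc : c' - c = 0 := (mul_eq_zero.1 h0).resolve_left hkpos.ne'
    exact Subtype.ext (funext fun i => by rw [hdiff, hcc, add_zero])
  · rintro ⟨lam, hcore, hle, hmod, hreach⟩
    obtain ⟨r, hr⟩ := (Nat.modEq_iff_dvd' hle).1 hmod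
    have hr' : (n : ℤ) * l = lam.cells.card + k * l * r := by
      have : n * l = lam.cells.card + k * l * r := by omega
      exact_mod_cast this
    obtain ⟨w, hw⟩ := hreach.res_eq
    have hcard : (lam.cells.card : ℤ) = w * l := by
      rw [← sum_Res l lam, Finset.sum_congr rfl fun i _ => hw i]
      simp [Res_bot]
      ring
    have hn : (n : ℤ) = w + k * r := by
      apply mul_right_cancel₀ hlpos.ne'
      rw [hr', hcard]
      ring
    have horb := (hcore.sameOrbit_zero hm).add_const (r : ℤ)
    rw [zero_add] at horb
    let d : {d : ZMod (k * l) → ℤ //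
        (∀ i : ZMod l,
          ∑ j ∈ Finset.univ.filter (fun j : ZMod (k * l) => ((j.val : ZMod l) = i)), d j
            = (n : ℤ)) ∧
        ∃ r : ℤ, 0 ≤ r ∧ SameOrbit (k * l) d (fun _ => r)} :=
      ⟨fun i => Res (k * l) lam i + r, fun i => by
        rw [Finset.sum_add_distrib, sum_fiber_Res, hw, Res_bot, Finset.sum_const, card_fiber,
          hn]
        simp, r, Int.natCast_nonneg r, horb⟩
    refine ⟨d, Subtype.ext ?_⟩
    obtain ⟨c, hc⟩ := hg d
    refine (g d).2.1.eq_of_res hcore (r + c) fun i => ?_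
    have := hc i
    simp only [d] at this ⊢
    linarith
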